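/- Let k ≥ 3 and A_1, ..., A_k be positive integers with n = 1 + A_1 + ... + A_k, and set α_{ij} = (n - 1 - A_i - A_j)(A_j - A_i) for 1 ≤ i, j ≤ k. The starlike tree S(A_1, A_2, ..., A_k) is transmission irregular if and only if all of the following hold: (i) the values A_1, ..., A_k are mutually distinct; (ii) A_i < n/2 for each 1 ≤ i ≤ k; (iii) for all 1 ≤ i < j ≤ k, the number α_{ij} has no positive divisor p ∈ ℕ with p > √|α_{ij}| such that: (a) p and α_{ij}/p have the same parity if and only if n is odd; (b) g(α_{ij}, n + 1 - 2·A_i) ≤ p ≤ g(α_{ij}, n - 1); (c) g(α_{ji}, n + 1 - 2·A_j) ≤ p ≤ g(α_{ji}, n - 1). -/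

import Mathlib

/-- The transmission of a vertex: sum of distances to all other vertices. -/
noncomputable def transmission {V : Type*} [Fintype V] (G : SimpleGraph V) (u : V) : ℕ :=
  ∑ v : V, G.dist u v

/-- A graph is transmission irregular if all vertices have distinct transmissions. -/
def TransmissionIrregular {V : Type*} [Fintype V] (G : SimpleGraph V) : Prop :=
  Function.Injective (transmission G)

/-- The starlike tree `S(A 0, …, A (k-1))`: a central vertex (`none`) with `k`
pendent paths attached, the `i`-th of length `A i`; `some ⟨i, j⟩` is the
`(j+1)`-st vertex on the `i`-th pendent path. -/
def starlikeTree (k : ℕ) (A : Fin k → ℕ) :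
    SimpleGraph (Option ((i : Fin k) × Fin (A i))) :=
  SimpleGraph.fromRel (fun x y =>
    match x, y with
    | none, some ⟨_, j⟩ => j.val = 0
    | some ⟨i, j⟩, some ⟨i', j'⟩ => i.val = i'.val ∧ j.val + 1 = j'.val
    | _, _ => False)

/-- The auxiliary function `g : ℝ × (0, ∞) → ℝ ∪ {-∞}`, with value
`(C₂ + √(C₂² - 4C₁))/2` when `C₂² - 4C₁ ≥ 0` and `-∞` otherwise. -/
noncomputable def gFun (c1 c2 : ℝ) : EReal :=
  if 0 ≤ c2 ^ 2 - 4 * c1 then ((c2 + Real.sqrt (c2 ^ 2 - 4 * c1)) / 2 : ℝ) else ⊥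

lemma SimpleGraph.dist_eq_of_step {V : Type*} {G : SimpleGraph V} {D : V → V → ℕ} {u : V}
    (h0 : D u u = 0) (h1 : ∀ v w, G.Adj v w → D u w ≤ D u v + 1)
    (h2 : ∀ v, v ≠ u → ∃ w, G.Adj w v ∧ D u w + 1 = D u v) (v : V) :
    G.dist u v = D u v := by
  have hwalk : ∀ d v, D u v = d → ∃ p : G.Walk u v, p.length = d := by
    intro d
    induction d with
    | zero =>
      intro v hv
      by_cases h : v = u
      · subst h
        exact ⟨SimpleGraph.Walk.nil, rfl⟩
      · obtain ⟨w, -, hw⟩ := h2 v h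
        omega
    | succ d ih =>
      intro v hv
      have h : v ≠ u := by
        rintro rfl
        omega
      obtain ⟨w, hadj, hw⟩ := h2 v h
      obtain ⟨p, hp⟩ := ih w (by omega)
      exact ⟨p.concat hadj, by simp [hp]⟩
  have hlow : ∀ {a b : V} (p : G.Walk a b), D u b ≤ D u a + p.length := by
    intro a b p
    induction p with
    | nil => simp
    | cons hadj p ih =>
      have := h1 _ _ hadj
      rw [SimpleGraph.Walk.length_cons]
      omega
  obtain ⟨p, hp⟩ := hwalk _ v rfl
  apply le_antisymm
  · exact hp ▸ SimpleGraph.dist_le p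
  · obtain ⟨q, hq⟩ := p.reachable.exists_walk_length_eq_dist
    have := hlow q
    omega

section Distance

variable {k : ℕ} {A : Fin k → ℕ}

@[simp] lemma starlikeTree_adj_none_some (x : (i : Fin k) × Fin (A i)) :
    (starlikeTree k A).Adj none (some x) ↔ x.2.val = 0 := by
  simp [starlikeTree]

@[simp] lemma starlikeTree_adj_some_none (x : (i : Fin k) × Fin (A i)) :
    (starlikeTree k A).Adj (some x) none ↔ x.2.val = 0 := by
  simp [starlikeTree]

@[simp] lemma starlikeTree_adj_some_some (x y : (i : Fin k) × Fin (A i)) :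
    (starlikeTree k A).Adj (some x) (some y) ↔
      x.1 = y.1 ∧ (x.2.val + 1 = y.2.val ∨ y.2.val + 1 = x.2.val) := by
  obtain ⟨i, a⟩ := x
  obtain ⟨j, b⟩ := y
  simp only [starlikeTree, SimpleGraph.fromRel_adj, Fin.val_inj]
  constructor
  · rintro ⟨-, ⟨h, h'⟩ | ⟨h, h'⟩⟩
    · exact ⟨h, Or.inl h'⟩
    · exact ⟨h.symm, Or.inr h'⟩
  · rintro ⟨h, h'⟩
    subst h
    refine ⟨?_, by tauto⟩
    simp only [ne_eq, Option.some.injEq, Sigma.mk.injEq, heq_eq_eq, true_and, Fin.ext_iff] at h' ⊢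
    omega

/-- The combinatorial formula for the distance in a starlike tree. -/
def starlikeDist : Option ((i : Fin k) × Fin (A i)) → Option ((i : Fin k) × Fin (A i)) → ℕ
  | none, none => 0
  | none, some y => y.2.val + 1
  | some x, none => x.2.val + 1
  | some x, some y =>
    if y.1 = x.1 then (x.2.val - y.2.val) + (y.2.val - x.2.val)
    else (x.2.val + 1) + (y.2.val + 1)

lemma starlikeTree_dist (u v : Option ((i : Fin k) × Fin (A i))) :
    (starlikeTree k A).dist u v = starlikeDist u v := by
  apply SimpleGraph.dist_eq_of_step
  · rcases u with _ | ⟨i, a⟩ <;> simp [starlikeDist]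
  · rintro (_ | ⟨j, b⟩) (_ | ⟨l, c⟩) h
    · simp at h
    · rcases u with _ | ⟨i, a⟩
      · simp_all [starlikeDist]
      · simp only [starlikeTree_adj_none_some] at h
        simp only [starlikeDist]
        split_ifs <;> omega
    · rcases u with _ | ⟨i, a⟩
      · simp_all [starlikeDist]
      · simp only [starlikeTree_adj_some_none] at h
        simp only [starlikeDist]
        split_ifs <;> omega
    · obtain ⟨h, h'⟩ := (starlikeTree_adj_some_some _ _).1 h
      dsimp only at h h'
      subst h
      rcases u with _ | ⟨i, a⟩
      · simp only [starlikeDist]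
        omega
      · simp only [starlikeDist]
        split_ifs <;> omega
  · have toward : ∀ (j : Fin k) (b : Fin (A j)), ∃ w,
        (starlikeTree k A).Adj w (some ⟨j, b⟩) ∧
          (w = none ∧ b.val = 0 ∨ ∃ c : Fin (A j), w = some ⟨j, c⟩ ∧ c.val + 1 = b.val) := by
      intro j b
      by_cases hb : b.val = 0
      · exact ⟨none, by simpa using hb, Or.inl ⟨rfl, hb⟩⟩
      · have hlt := b.isLt
        refine ⟨some ⟨j, ⟨b.val - 1, by omega⟩⟩, ?_, Or.inr ⟨_, rfl, ?_⟩⟩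
        · simp only [starlikeTree_adj_some_some, true_and]
          omega
        · dsimp only
          omega
    rintro (_ | ⟨j, b⟩) hv
    · rcases u with _ | ⟨i, a⟩
      · exact absurd rfl hv
      · have hlt := a.isLt
        refine ⟨some ⟨i, ⟨0, by omega⟩⟩, by simp, ?_⟩
        simp [starlikeDist]
    · obtain ⟨w, hadj, hw⟩ := toward j b
      rcases u with _ | ⟨i, a⟩
      · refine ⟨w, hadj, ?_⟩
        rcases hw with ⟨rfl, hb⟩ | ⟨c, rfl, hc⟩ <;> simp only [starlikeDist] <;> omega
      · by_cases hij : j = i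
        · subst hij
          have hab : b.val ≠ a.val := by
            intro h
            exact hv (by rw [Fin.ext h])
          by_cases hlt : b.val < a.val
          · have ha := a.isLt
            refine ⟨some ⟨j, ⟨b.val + 1, by omega⟩⟩, by simp, ?_⟩
            simp only [starlikeDist, if_true]
            omega
          · refine ⟨w, hadj, ?_⟩
            rcases hw with ⟨rfl, hb⟩ | ⟨c, rfl, hc⟩ <;> simp only [starlikeDist, if_true] <;> omega
        · refine ⟨w, hadj, ?_⟩
          rcases hw with ⟨rfl, hb⟩ | ⟨c, rfl, hc⟩ <;> simp only [starlikeDist, if_neg hij] <;> omega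

lemma sum_path_dist_sub (t a : ℕ) (h : t < a) :
    ∑ j ∈ Finset.range a, ((((t - j) + (j - t) : ℕ) : ℤ) - (j + 1)) =
      ((t : ℤ) + 1) ^ 2 - (t + 1) - (t + 1) * a := by
  have hbelow : ∀ b : ℕ, b ≤ t + 1 →
      ∑ j ∈ Finset.range b, ((((t - j) + (j - t) : ℕ) : ℤ) - (j + 1)) = b * (t - b) := by
    intro b hb
    induction b with
    | zero => simp
    | succ b ih =>
      rw [Finset.sum_range_succ, ih (by omega)]
      have : (((t - b) + (b - t) : ℕ) : ℤ) = t - b := by omega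
      rw [this]
      push_cast
      ring
  induction a, h using Nat.le_induction with
  | base =>
    rw [hbelow _ (by omega)]
    push_cast
    ring
  | succ b hb ih =>
    rw [Finset.sum_range_succ, ih]
    have : (((t - b) + (b - t) : ℕ) : ℤ) = b - t := by omega
    rw [this]
    push_cast
    ring

lemma transmission_starlikeTree_some (i : Fin k) (a : Fin (A i)) :
    (transmission (starlikeTree k A) (some ⟨i, a⟩) : ℤ) =
      transmission (starlikeTree k A) none +
        ((a : ℤ) + 1) * ((a : ℤ) + 1 + ((∑ l, A l : ℕ) : ℤ) - 2 * A i) := by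
  have hbranch : ∀ l : Fin k,
      ∑ b : Fin (A l), ((starlikeDist (some ⟨i, a⟩) (some ⟨l, b⟩) : ℤ) - ((b : ℤ) + 1)) =
        (if l = i then ((a : ℤ) + 1) ^ 2 - (a + 1) - 2 * (a + 1) * A i else 0) +
          (a + 1) * A l := by
    intro l
    by_cases h : l = i
    · subst h
      simp only [starlikeDist, if_true]
      rw [Fin.sum_univ_eq_sum_range
        (fun j : ℕ => ((((a : ℕ) - j) + (j - (a : ℕ)) : ℕ) : ℤ) - ((j : ℤ) + 1)),
        sum_path_dist_sub _ _ a.isLt]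
      ring
    · simp only [starlikeDist, if_neg h]
      push_cast
      simp
      ring
  have hdiff : (transmission (starlikeTree k A) (some ⟨i, a⟩) : ℤ) -
      transmission (starlikeTree k A) none = (a + 1) + ∑ l : Fin k, ∑ b : Fin (A l),
        ((starlikeDist (some ⟨i, a⟩) (some ⟨l, b⟩) : ℤ) - ((b : ℤ) + 1)) := by
    simp only [transmission, starlikeTree_dist, Fintype.sum_option, Fintype.sum_sigma,
      Finset.sum_sub_distrib]
    simp only [starlikeDist]
    push_cast
    ring
  simp only [hbranch, Finset.sum_add_distrib, Finset.sum_ite_eq', Finset.mem_univ, if_true,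
    ← Finset.mul_sum] at hdiff
  push_cast
  linarith

end Distance

section Arithmetic

lemma gFun_le_iff {p q : ℝ} (C : ℝ) (hq : |q| < p) :
    gFun (p * q) C ≤ ((p : ℝ) : EReal) ↔ C ≤ p + q := by
  obtain ⟨h1, h2⟩ := abs_lt.1 hq
  unfold gFun
  split_ifs with hd
  · rw [EReal.coe_le_coe_iff]
    constructor
    · intro h
      have h3 : √(C ^ 2 - 4 * (p * q)) ≤ 2 * p - C := by linarith
      have h4 := (Real.sqrt_le_iff.1 h3).2
      nlinarith
    · intro h
      have h3 : √(C ^ 2 - 4 * (p * q)) ≤ 2 * p - C :=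
        Real.sqrt_le_iff.2 ⟨by linarith, by nlinarith⟩
      linarith
  · simp only [bot_le, true_iff]
    by_contra h
    nlinarith [sq_nonneg (p - q)]

lemma le_gFun_iff {p q : ℝ} (C : ℝ) (hq : |q| < p) :
    ((p : ℝ) : EReal) ≤ gFun (p * q) C ↔ p + q ≤ C := by
  obtain ⟨h1, h2⟩ := abs_lt.1 hq
  unfold gFun
  split_ifs with hd
  · rw [EReal.coe_le_coe_iff]
    constructor
    · intro h
      by_contra! hC
      have h3 : 2 * p - C ≤ √(C ^ 2 - 4 * (p * q)) := by linarith
      have h4 := (Real.le_sqrt' (by linarith)).1 h3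
      nlinarith
    · intro h
      have h3 : 2 * p - C ≤ √(C ^ 2 - 4 * (p * q)) := Real.le_sqrt_of_sq_le (by nlinarith)
      linarith
  · simp only [le_bot_iff, EReal.coe_ne_bot, false_iff]
    intro h
    nlinarith [sq_nonneg (p - q)]

lemma sqrt_abs_mul_lt_iff {p q : ℝ} (hp : 0 < p) : √|p * q| < p ↔ |q| < p := by
  rw [Real.sqrt_lt' hp, abs_mul, abs_of_pos hp, sq, mul_lt_mul_iff_right₀ hp]

/-- Factorizations of `(n - 1 - a - b) * (b - a)` in the prescribed range correspond to equal
values of the two quadratic polynomials. -/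
lemma exists_divisor_iff_exists_collision {n a b α β : ℤ}
    (ha : 2 * a < n) (hb : 2 * b < n)
    (hα : α = (n - 1 - a - b) * (b - a)) (hβ : β = (n - 1 - b - a) * (a - b)) :
    (∃ p : ℤ, 0 < p ∧ p ∣ α ∧ √|(α : ℝ)| < (p : ℝ) ∧ ((p ≡ α / p [ZMOD 2]) ↔ Odd n) ∧
        (gFun (α : ℝ) ((n : ℝ) + 1 - 2 * (a : ℝ)) ≤ ((p : ℝ) : EReal) ∧
          ((p : ℝ) : EReal) ≤ gFun (α : ℝ) ((n : ℝ) - 1)) ∧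
        (gFun (β : ℝ) ((n : ℝ) + 1 - 2 * (b : ℝ)) ≤ ((p : ℝ) : EReal) ∧
          ((p : ℝ) : EReal) ≤ gFun (β : ℝ) ((n : ℝ) - 1))) ↔
      ∃ x y : ℤ, (1 ≤ x ∧ x ≤ a) ∧ (1 ≤ y ∧ y ≤ b) ∧
        x * (x + (n - 1) - 2 * a) = y * (y + (n - 1) - 2 * b) := by
  have hβα : β = -α := by rw [hα, hβ]; ring
  have key : ∀ p q : ℤ, 0 < p → α = p * q →
      ((√|(α : ℝ)| < (p : ℝ) ∧ ((p ≡ α / p [ZMOD 2]) ↔ Odd n) ∧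
        (gFun (α : ℝ) ((n : ℝ) + 1 - 2 * (a : ℝ)) ≤ ((p : ℝ) : EReal) ∧
          ((p : ℝ) : EReal) ≤ gFun (α : ℝ) ((n : ℝ) - 1)) ∧
        (gFun (β : ℝ) ((n : ℝ) + 1 - 2 * (b : ℝ)) ≤ ((p : ℝ) : EReal) ∧
          ((p : ℝ) : EReal) ≤ gFun (β : ℝ) ((n : ℝ) - 1))) ↔
      (|q| < p ∧ (p + q + n) % 2 = 1 ∧ (n + 1 - 2 * a ≤ p + q ∧ p + q ≤ n - 1) ∧
        (n + 1 - 2 * b ≤ p - q ∧ p - q ≤ n - 1))) := by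
    intro p q hp hpq
    have hdiv : α / p = q := by rw [hpq, Int.mul_ediv_cancel_left _ hp.ne']
    have hpar : ((p ≡ q [ZMOD 2]) ↔ Odd n) ↔ (p + q + n) % 2 = 1 := by
      rw [Int.odd_iff, Int.ModEq]
      omega
    have hαR : (α : ℝ) = (p : ℝ) * (q : ℝ) := by rw [hpq]; push_cast; ring
    have hβR : (β : ℝ) = (p : ℝ) * (-(q : ℝ)) := by rw [hβα, hpq]; push_cast; ring
    have hpR : (0 : ℝ) < p := by exact_mod_cast hp
    rw [hdiv, hpar, hαR, hβR, sqrt_abs_mul_lt_iff hpR]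
    have habs : |(q : ℝ)| < p ↔ |q| < p := by norm_cast
    rw [← habs]
    refine and_congr_right fun hq => ?_
    have hq' : |-(q : ℝ)| < p := by rwa [abs_neg]
    rw [gFun_le_iff _ hq, le_gFun_iff _ hq, gFun_le_iff _ hq', le_gFun_iff _ hq',
      ← sub_eq_add_neg]
    norm_cast
  constructor
  · rintro ⟨p, hp, ⟨q, hpq⟩, h⟩
    obtain ⟨-, hpar, ⟨h1, h2⟩, h3, h4⟩ := (key p q hp hpq).1 h
    obtain ⟨x, hx⟩ : ∃ x, p + q = 2 * x + (n - 1 - 2 * a) :=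
      ⟨(p + q - (n - 1 - 2 * a)) / 2, by omega⟩
    obtain ⟨y, hy⟩ : ∃ y, p - q = 2 * y + (n - 1 - 2 * b) :=
      ⟨(p - q - (n - 1 - 2 * b)) / 2, by omega⟩
    refine ⟨x, y, by omega, by omega, ?_⟩
    have hp' : p = x + y + (n - 1 - a - b) := by omega
    have hq' : q = x - y + (b - a) := by omega
    rw [hα, hp', hq'] at hpq
    linarith
  · rintro ⟨x, y, hx, hy, hxy⟩
    have hp : 0 < x + y + (n - 1 - a - b) := by omega
    have hpq : α = (x + y + (n - 1 - a - b)) * (x - y + (b - a)) := by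
      rw [hα]
      linarith
    refine ⟨_, hp, ⟨_, hpq⟩, (key _ _ hp hpq).2 ⟨abs_lt.2 (by omega), by omega, by omega, by omega⟩⟩

end Arithmetic

lemma transmissionIrregular_starlikeTree_iff {k : ℕ} {A : Fin k → ℕ} {n : ℕ}
    (hA : ∀ i, 0 < A i) (hn : n = 1 + ∑ i, A i) :
    TransmissionIrregular (starlikeTree k A) ↔
      Function.Injective A ∧ (∀ i, 2 * A i < n) ∧
        ∀ i j : Fin k, i < j → ¬ ∃ x y : ℤ, (1 ≤ x ∧ x ≤ A i) ∧ (1 ≤ y ∧ y ≤ A j) ∧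
          x * (x + ((n : ℤ) - 1) - 2 * A i) = y * (y + ((n : ℤ) - 1) - 2 * A j) := by
  have hT : ∀ (i : Fin k) (a : Fin (A i)),
      (transmission (starlikeTree k A) (some ⟨i, a⟩) : ℤ) =
        transmission (starlikeTree k A) none +
          ((a : ℤ) + 1) * ((a : ℤ) + 1 + ((n : ℤ) - 1) - 2 * A i) := by
    intro i a
    rw [transmission_starlikeTree_some, hn]
    push_cast
    ring
  constructor
  · intro h
    have hcoll : ∀ i j : Fin k, i ≠ j →
        ¬ ∃ x y : ℤ, (1 ≤ x ∧ x ≤ A i) ∧ (1 ≤ y ∧ y ≤ A j) ∧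
          x * (x + ((n : ℤ) - 1) - 2 * A i) = y * (y + ((n : ℤ) - 1) - 2 * A j) := by
      rintro i j hij ⟨x, y, hx, hy, hxy⟩
      have hx' := hT i ⟨(x - 1).toNat, by omega⟩
      have hy' := hT j ⟨(y - 1).toNat, by omega⟩
      have ex : (((x - 1).toNat : ℕ) : ℤ) + 1 = x := by omega
      have ey : (((y - 1).toNat : ℕ) : ℤ) + 1 = y := by omega
      simp only [ex] at hx'
      simp only [ey] at hy'
      rw [hxy, ← hy', Nat.cast_inj] at hx'
      have := h hx'
      simp only [Option.some.injEq, Sigma.mk.injEq] at this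
      exact hij this.1
    refine ⟨?_, ?_, fun i j hij => hcoll i j hij.ne⟩
    · intro i j hij
      by_contra hne
      have := hA i
      exact hcoll i j hne ⟨1, 1, by omega, by omega, by rw [hij]⟩
    · intro i
      by_contra! hi
      have hle : A i ≤ ∑ l, A l := Finset.single_le_sum (fun _ _ => Nat.zero_le _)
        (Finset.mem_univ i)
      have hx' := hT i ⟨2 * A i - n, by omega⟩
      have ex : ((2 * A i - n : ℕ) : ℤ) + 1 + ((n : ℤ) - 1) - 2 * A i = 0 := by omega
      simp only [ex, mul_zero, add_zero, Nat.cast_inj] at hx'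
      exact Option.some_ne_none _ (h hx')
  · rintro ⟨-, hlt, hcoll⟩
    have hpos : ∀ (i : Fin k) (a : Fin (A i)),
        0 < ((a : ℤ) + 1) * ((a : ℤ) + 1 + ((n : ℤ) - 1) - 2 * A i) := by
      intro i a
      have := hlt i
      exact mul_pos (by omega) (by omega)
    rintro (_ | ⟨i, a⟩) (_ | ⟨j, b⟩) huv
    · rfl
    · have := hT j b
      have := hpos j b
      omega
    · have := hT i a
      have := hpos i a
      omega
    · have hab : ((a : ℤ) + 1) * ((a : ℤ) + 1 + ((n : ℤ) - 1) - 2 * A i) =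
          ((b : ℤ) + 1) * ((b : ℤ) + 1 + ((n : ℤ) - 1) - 2 * A j) := by
        have h1 := hT i a
        have h2 := hT j b
        omega
      have ha := a.isLt
      have hb := b.isLt
      rcases lt_trichotomy i j with hij | rfl | hij
      · exact absurd ⟨_, _, by omega, by omega, hab⟩ (hcoll i j hij)
      · have hi := hlt i
        have hfac : ((a : ℤ) - b) * ((a : ℤ) + b + 2 + ((n : ℤ) - 1) - 2 * A i) = 0 := by
          linarith
        rcases mul_eq_zero.1 hfac with h | h
        · have : a = b := Fin.ext (by omega)
          rw [this]
        · omega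
      · exact absurd ⟨_, _, by omega, by omega, hab.symm⟩ (hcoll j i hij)

/-- Complete characterization of transmission irregular starlike trees
(Theorem 2 of the paper). -/
theorem starlike_TI_characterization (k : ℕ) (hk : 3 ≤ k)
    (A : Fin k → ℕ) (hA : ∀ i, 0 < A i) (n : ℕ) (hn : n = 1 + ∑ i, A i)
    (α : Fin k → Fin k → ℤ)
    (hα : ∀ i j, α i j = ((n : ℤ) - 1 - (A i : ℤ) - (A j : ℤ)) * ((A j : ℤ) - (A i : ℤ))) :
    TransmissionIrregular (starlikeTree k A) ↔
      (Function.Injective A ∧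
       (∀ i, 2 * A i < n) ∧
       (∀ i j : Fin k, i < j →
          ¬ ∃ p : ℤ, 0 < p ∧ p ∣ α i j ∧
            Real.sqrt |((α i j : ℤ) : ℝ)| < (p : ℝ) ∧
            ((p ≡ α i j / p [ZMOD 2]) ↔ Odd n) ∧
            (gFun ((α i j : ℤ) : ℝ) ((n : ℝ) + 1 - 2 * (A i : ℝ)) ≤ ((p : ℝ) : EReal) ∧
              ((p : ℝ) : EReal) ≤ gFun ((α i j : ℤ) : ℝ) ((n : ℝ) - 1)) ∧
            (gFun ((α j i : ℤ) : ℝ) ((n : ℝ) + 1 - 2 * (A j : ℝ)) ≤ ((p : ℝ) : EReal) ∧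
              ((p : ℝ) : EReal) ≤ gFun ((α j i : ℤ) : ℝ) ((n : ℝ) - 1)))) := by
  rw [transmissionIrregular_starlikeTree_iff hA hn]
  refine and_congr_right fun _ => and_congr_right fun hlt =>
    forall_congr' fun i => forall_congr' fun j => imp_congr_right fun _ => not_congr ?_
  have h := exists_divisor_iff_exists_collision (n := n) (a := A i) (b := A j)
    (by exact_mod_cast hlt i) (by exact_mod_cast hlt j) (hα i j) (hα j i)
  simpa only [Int.cast_natCast, Int.odd_coe_nat] using h.symm
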